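/- arXiv:1811.02437 — 2 statements merged into one kernel-verified Lean document; each statement's English description precedes it below -/
import Mathlib

section
/- Let p ≥ 2 be an integer, q = exp(iπ/p), and 1 ≤ n ≤ p−1. Define the linear map G_n : V^⊗n → V^⊗n on basis vectors of weight k (0 ≤ k ≤ n) by G_n(ρ_{i₁,…,i_k,n}) = q^{kn − (k²−k)/2 − (i₁+⋯+i_k)}·(([n−k]!)/([n]!))·F_n^k x_{0,n}. Then G_n∘G_n = G_n, and G_n∘e_j = 0 and e_j∘G_n = 0 for all 1 ≤ j ≤ n−1, where e_j = ∩_j∘∪_j on V^⊗n; that is, G_n is the Jones–Wenzl projection. -/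
noncomputable section

/-- The quantum integer `[n] = (q^n - q^{-n})/(q - q⁻¹)`. -/
def qint (q : ℂ) (n : ℤ) : ℂ := (q ^ n - q ^ (-n)) / (q - q⁻¹)

/-- The quantum factorial `[n]! = [1][2]⋯[n]`, with `[0]! = 1`. -/
def qfact (q : ℂ) (n : ℕ) : ℂ := ∏ m ∈ Finset.range n, qint q ((m : ℤ) + 1)

/-- Binary strings of length `z`, indexing the standard basis of `V^{⊗z}` for `V = ℂ²`:
value `1` at a position means `ν₁` there, value `0` means `ν₀`. -/
abbrev Str (z : ℕ) := Fin z → Fin 2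

/-- `V^{⊗z}`, modelled by coordinates with respect to the standard basis of tensors of
`ν₀`'s and `ν₁`'s. -/
abbrev Vz (z : ℕ) := Str z → ℂ

/-- The basis vector `ρ_{i₁,…,i_k,z}` of `V^{⊗z}` having `ν₁` exactly at the positions in `S`
and `ν₀` elsewhere. -/
def rho (z : ℕ) (S : Finset (Fin z)) : Vz z :=
  fun t => if t = (fun j => if j ∈ S then 1 else 0) then 1 else 0

/-- `x_{0,z} = ν₀^{⊗z}`. -/
def x0 (z : ℕ) : Vz z := rho z ∅

/-- `x_{z,z} = ν₁^{⊗z}`. -/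
def xtop (z : ℕ) : Vz z := rho z Finset.univ

/-- The set of positions of a basis string carrying `ν₁`. -/
def onesOf {z : ℕ} (s : Str z) : Finset (Fin z) := Finset.univ.filter fun j => s j = 1

/-- `i₁ + ⋯ + i_k`, the sum of the (1-indexed) positions in `S`. -/
def posSum {z : ℕ} (S : Finset (Fin z)) : ℤ := ∑ j ∈ S, (((j : ℕ) : ℤ) + 1)

/-- The `K`-weight exponent of a basis vector of `V`: `Kν₀ = qν₀`, `Kν₁ = q⁻¹ν₁`. -/
def kwt (v : Fin 2) : ℤ := if v = 0 then 1 else -1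

/-- Matrix of `E_z = Σᵢ 1^{⊗(i-1)} ⊗ E ⊗ K^{⊗(z-i)}` on `V^{⊗z}`. -/
def Emat (q : ℂ) (z : ℕ) : Matrix (Str z) (Str z) ℂ := fun t s =>
  ∑ i : Fin z,
    if s i = 1 ∧ t = Function.update s i 0 then
      q ^ (∑ j ∈ Finset.univ.filter (fun j => i < j), kwt (s j)) else 0

/-- Matrix of `F_z = Σᵢ (K⁻¹)^{⊗(i-1)} ⊗ F ⊗ 1^{⊗(z-i)}` on `V^{⊗z}`. -/
def Fmat (q : ℂ) (z : ℕ) : Matrix (Str z) (Str z) ℂ := fun t s =>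
  ∑ i : Fin z,
    if s i = 0 ∧ t = Function.update s i 1 then
      q ^ (-∑ j ∈ Finset.univ.filter (fun j => j < i), kwt (s j)) else 0

/-- `E_z` as a linear operator on `V^{⊗z}`. -/
def EOp (q : ℂ) (z : ℕ) : Module.End ℂ (Vz z) := (Emat q z).mulVecLin

/-- `F_z` as a linear operator on `V^{⊗z}`. -/
def FOp (q : ℂ) (z : ℕ) : Module.End ℂ (Vz z) := (Fmat q z).mulVecLin

/-- Matrix of the map `α : V^{⊗(2p-1)} → V^{⊗(2p-1)}`, with
`α(ρ_{i₁,…,i_k,2p-1}) = q^{k(2p-1) - (k²-k)/2 - Σᵢ iⱼ}·[k]!·E_{2p-1}^{p-k-1} x_{2p-1,2p-1}`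
for `k ≤ p-1`, and `α(ρ_{i₁,…,i_k,2p-1}) = 0` for `k ≥ p`. -/
def alphaMat (q : ℂ) (p : ℕ) : Matrix (Str (2 * p - 1)) (Str (2 * p - 1)) ℂ := fun t s =>
  let k := (onesOf s).card
  if k < p then
    (q ^ ((k : ℤ) * ((2 * p - 1 : ℕ) : ℤ) - ((k : ℤ) ^ 2 - (k : ℤ)) / 2 - posSum (onesOf s))
        * qfact q k)
      * ((EOp q (2 * p - 1) ^ (p - 1 - k)) (xtop (2 * p - 1)) t)
  else 0

/-- Matrix of the map `β : V^{⊗(2p-1)} → V^{⊗(2p-1)}`, with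
`β(ρ_{i₁,…,i_k,2p-1}) = q^{k(2p-1) - (k²-k)/2 - Σᵢ iⱼ}·[2p-1-k]!·F_{2p-1}^{k-p} x_{0,2p-1}`
for `k ≥ p`, and `β(ρ_{i₁,…,i_k,2p-1}) = 0` for `k ≤ p-1`. -/
def betaMat (q : ℂ) (p : ℕ) : Matrix (Str (2 * p - 1)) (Str (2 * p - 1)) ℂ := fun t s =>
  let k := (onesOf s).card
  if p ≤ k then
    (q ^ ((k : ℤ) * ((2 * p - 1 : ℕ) : ℤ) - ((k : ℤ) ^ 2 - (k : ℤ)) / 2 - posSum (onesOf s))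
        * qfact q (2 * p - 1 - k))
      * ((FOp q (2 * p - 1) ^ (k - p)) (x0 (2 * p - 1)) t)
  else 0

/-- The operator `α` on `V^{⊗(2p-1)}`. -/
def alphaOp (q : ℂ) (p : ℕ) : Module.End ℂ (Vz (2 * p - 1)) := (alphaMat q p).mulVecLin

/-- The operator `β` on `V^{⊗(2p-1)}`. -/
def betaOp (q : ℂ) (p : ℕ) : Module.End ℂ (Vz (2 * p - 1)) := (betaMat q p).mulVecLin

/-- `1^{⊗a} ⊗ M ⊗ 1^{⊗(n-a-c)}`: the amplification of a matrix `M` acting on `c` tensor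
factors to `V^{⊗n}`, placed on the factor positions `a+1, …, a+c` (1-indexed). -/
def ampMat (n a c : ℕ) (h : a + c ≤ n) (M : Matrix (Str c) (Str c) ℂ) :
    Matrix (Str n) (Str n) ℂ := fun t s =>
  if ∀ j : Fin n, ((j : ℕ) < a ∨ a + c ≤ (j : ℕ)) → t j = s j then
    M (fun j => t ⟨a + (j : ℕ), by have := j.isLt; omega⟩)
      (fun j => s ⟨a + (j : ℕ), by have := j.isLt; omega⟩)
  else 0

/-- `α_i = 1^{⊗(i-1)} ⊗ α ⊗ 1^{⊗(n-2p+2-i)}` on `V^{⊗n}` (with `i` 1-indexed). -/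
def alphaOpAt (q : ℂ) (p n i : ℕ) (h : (i - 1) + (2 * p - 1) ≤ n) : Module.End ℂ (Vz n) :=
  (ampMat n (i - 1) (2 * p - 1) h (alphaMat q p)).mulVecLin

/-- `β_i = 1^{⊗(i-1)} ⊗ β ⊗ 1^{⊗(n-2p+2-i)}` on `V^{⊗n}` (with `i` 1-indexed). -/
def betaOpAt (q : ℂ) (p n i : ℕ) (h : (i - 1) + (2 * p - 1) ≤ n) : Module.End ℂ (Vz n) :=
  (ampMat n (i - 1) (2 * p - 1) h (betaMat q p)).mulVecLin

/-- Matrix of `∪` applied at the (0-indexed) positions `i, i+1` of `N = M + 2` strands: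
`∪(ν₀⊗ν₀) = ∪(ν₁⊗ν₁) = 0`, `∪(ν₁⊗ν₀) = 1`, `∪(ν₀⊗ν₁) = -q`. -/
def cupMat (q : ℂ) (N M i : ℕ) (h : N = M + 2) (hi : i + 1 < N) :
    Matrix (Str M) (Str N) ℂ := fun t s =>
  if ∀ j : Fin M,
      t j = s ⟨if (j : ℕ) < i then (j : ℕ) else (j : ℕ) + 2, by
        have := j.isLt; split <;> omega⟩ then
    (if s ⟨i, by omega⟩ = 1 ∧ s ⟨i + 1, hi⟩ = 0 then 1
     else if s ⟨i, by omega⟩ = 0 ∧ s ⟨i + 1, hi⟩ = 1 then -q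
     else 0)
  else 0

/-- Matrix of `∩` inserted at the (0-indexed) positions `i, i+1` of `N = M + 2` strands:
`∩(1) = q⁻¹ ν₁⊗ν₀ - ν₀⊗ν₁`. -/
def capMat (q : ℂ) (N M i : ℕ) (h : N = M + 2) (hi : i + 1 < N) :
    Matrix (Str N) (Str M) ℂ := fun t s =>
  if ∀ j : Fin M,
      s j = t ⟨if (j : ℕ) < i then (j : ℕ) else (j : ℕ) + 2, by
        have := j.isLt; split <;> omega⟩ then
    (if t ⟨i, by omega⟩ = 1 ∧ t ⟨i + 1, hi⟩ = 0 then q⁻¹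
     else if t ⟨i, by omega⟩ = 0 ∧ t ⟨i + 1, hi⟩ = 1 then -1
     else 0)
  else 0

/-- `∪_{i+1} : V^{⊗N} → V^{⊗M}`, `N = M + 2` (here `i` is the 0-indexed position). -/
def cupOp (q : ℂ) (N M i : ℕ) (h : N = M + 2) (hi : i + 1 < N) : Vz N →ₗ[ℂ] Vz M :=
  (cupMat q N M i h hi).mulVecLin

/-- `∩_{i+1} : V^{⊗M} → V^{⊗N}`, `N = M + 2` (here `i` is the 0-indexed position). -/
def capOp (q : ℂ) (N M i : ℕ) (h : N = M + 2) (hi : i + 1 < N) : Vz M →ₗ[ℂ] Vz N :=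
  (capMat q N M i h hi).mulVecLin

/-- Matrix of the Jones–Wenzl-type map `G_n` on `V^{⊗n}`:
`G_n(ρ_{i₁,…,i_k,n}) = q^{kn - (k²-k)/2 - Σ iⱼ}·([n-k]!/[n]!)·F_n^k x_{0,n}`. -/
def jwMat (q : ℂ) (n : ℕ) : Matrix (Str n) (Str n) ℂ := fun t s =>
  let k := (onesOf s).card
  (q ^ ((k : ℤ) * (n : ℤ) - ((k : ℤ) ^ 2 - (k : ℤ)) / 2 - posSum (onesOf s))
      * (qfact q (n - k) / qfact q n))
    * ((FOp q n ^ k) (x0 n) t)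

/-- The Jones–Wenzl-type map `G_n` on `V^{⊗n}`. -/
def jwOp (q : ℂ) (n : ℕ) : Module.End ℂ (Vz n) := (jwMat q n).mulVecLin

/-- `v ⊗ ν_a : V^{⊗z} ⊗ V → V^{⊗(z+1)}` (appending a basis vector of `V` on the right). -/
def appendR {z : ℕ} (v : Vz z) (a : Fin 2) : Vz (z + 1) :=
  fun t => if t (Fin.last z) = a then v (fun j => t j.castSucc) else 0

/-- `ν_a ⊗ v : V ⊗ V^{⊗z} → V^{⊗(z+1)}` (appending a basis vector of `V` on the left). -/
def appendL {z : ℕ} (a : Fin 2) (v : Vz z) : Vz (z + 1) :=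
  fun t => if t 0 = a then v (fun j => t j.succ) else 0

/-- `ξ_{n,z} = Σ_{1 ≤ i₁ < ⋯ < i_n ≤ z} q^{-2(i₁+⋯+i_n)}`. -/
def xiSum (q : ℂ) (n z : ℕ) : ℂ :=
  ∑ S ∈ Finset.powersetCard n (Finset.univ : Finset (Fin z)), q ^ (-2 * posSum S)

section Strings

variable {z : ℕ}

lemma mem_onesOf {s : Str z} {i : Fin z} : i ∈ onesOf s ↔ s i = 1 := by
  simp [onesOf]

lemma fin_two_ne_one {a : Fin 2} : a ≠ 1 ↔ a = 0 := by
  revert a; decide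

lemma onesOf_update_zero (s : Str z) (i : Fin z) :
    onesOf (Function.update s i 0) = (onesOf s).erase i := by
  ext j
  rw [Finset.mem_erase, mem_onesOf, mem_onesOf]
  by_cases h : j = i <;> simp [h]

lemma posSum_erase {S : Finset (Fin z)} {i : Fin z} (hi : i ∈ S) :
    posSum (S.erase i) = posSum S - ((i : ℕ) + 1) := by
  rw [posSum, posSum, ← Finset.sum_erase_add _ _ hi]
  ring

/-- Binary strings of length `z` correspond to their sets of ones. -/
def onesEquiv (z : ℕ) : Str z ≃ Finset (Fin z) where
  toFun := onesOf
  invFun S j := if j ∈ S then 1 else 0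
  left_inv s := by
    funext j
    by_cases h : s j = 1
    · simp [mem_onesOf, h]
    · simp [mem_onesOf, fin_two_ne_one.1 h]
  right_inv S := by
    ext j
    simp [mem_onesOf]

lemma onesOf_swap {s : Str z} {i j : Fin z} (hi : s i = 1) (hj : s j = 0) :
    onesOf (s ∘ Equiv.swap i j) = insert j ((onesOf s).erase i) := by
  have hij : i ≠ j := by rintro rfl; simp_all
  ext k
  rw [Finset.mem_insert, Finset.mem_erase, mem_onesOf, mem_onesOf, Function.comp_apply]
  by_cases hki : k = i
  · subst hki; simp [hj, hij]
  · by_cases hkj : k = j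
    · subst hkj; simp [hi]
    · simp [Equiv.swap_apply_of_ne_of_ne hki hkj, hki, hkj]

lemma card_onesOf_swap {s : Str z} {i j : Fin z} (hi : s i = 1) (hj : s j = 0) :
    (onesOf (s ∘ Equiv.swap i j)).card = (onesOf s).card := by
  rw [onesOf_swap hi hj, Finset.card_insert_of_notMem (by simp [mem_onesOf, hj]),
    Finset.card_erase_add_one (mem_onesOf.2 hi)]

lemma posSum_onesOf_swap {s : Str z} {i j : Fin z} (hi : s i = 1) (hj : s j = 0) :
    posSum (onesOf (s ∘ Equiv.swap i j)) = posSum (onesOf s) + j - i := by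
  have h := posSum_erase (mem_onesOf.2 hi)
  rw [onesOf_swap hi hj, posSum, Finset.sum_insert (by simp [mem_onesOf, hj]), ← posSum, h]
  ring

lemma kwt_eq (v : Fin 2) : kwt v = 1 - 2 * (if v = 1 then 1 else 0) := by
  revert v; decide

lemma sum_kwt_lt (t : Str z) (i : Fin z) :
    ∑ j ∈ Finset.univ.filter (fun j => j < i), kwt (t j)
      = i - 2 * ((onesOf t).filter (fun j => j < i)).card := by
  have h : (onesOf t).filter (fun j => j < i)
      = (Finset.univ.filter (fun j => j < i)).filter (fun j => t j = 1) := by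
    ext j; simp [mem_onesOf, and_comm]
  simp_rw [kwt_eq]
  rw [Finset.sum_sub_distrib, ← Finset.mul_sum, h, Finset.sum_boole,
    show Finset.univ.filter (fun j => j < i) = Finset.Iio i by ext; simp]
  simp

end Strings

section QuantumIntegers

lemma sum_pow_card_filter_lt {α : Type*} [LinearOrder α] {R : Type*} [CommSemiring R]
    (x : R) (S : Finset α) :
    ∑ i ∈ S, x ^ (S.filter (fun j => j < i)).card = ∑ m ∈ Finset.range S.card, x ^ m := by
  induction S using Finset.induction_on_max with
  | empty => simp
  | insert a S ha ih =>
    have hnot : a ∉ S := fun h => lt_irrefl _ (ha a h)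
    rw [Finset.sum_insert hnot, Finset.card_insert_of_notMem hnot, Finset.sum_range_succ, ← ih,
      add_comm]
    congr 1
    · refine Finset.sum_congr rfl fun i hi => ?_
      rw [Finset.filter_insert, if_neg (ha i hi).not_gt]
    · rw [Finset.filter_insert, if_neg (lt_irrefl a), Finset.filter_true_of_mem ha]

lemma qfact_succ (q : ℂ) (n : ℕ) : qfact q (n + 1) = qfact q n * qint q (n + 1) :=
  Finset.prod_range_succ _ _

lemma sub_inv_ne_zero {q : ℂ} (hq0 : q ≠ 0) (hq2 : q ^ 2 ≠ 1) : q - q⁻¹ ≠ 0 := by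
  intro h
  apply hq2
  field_simp at h
  linear_combination h

lemma sum_pow_eq_qint {q : ℂ} (hq0 : q ≠ 0) (hq2 : q ^ 2 ≠ 1) (k : ℕ) :
    ∑ m ∈ Finset.range (k + 1), (q ^ 2) ^ m = q ^ (k : ℤ) * qint q (k + 1) := by
  have h1 : q ^ 2 - 1 ≠ 0 := sub_ne_zero.2 hq2
  rw [geom_sum_eq hq2, qint, zpow_neg, show (k : ℤ) + 1 = ((k + 1 : ℕ) : ℤ) by push_cast; rfl,
    zpow_natCast, zpow_natCast]
  have h2 : q - q⁻¹ ≠ 0 := sub_inv_ne_zero hq0 hq2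
  rw [mul_div_assoc', div_eq_div_iff h1 h2]
  field_simp
  ring

lemma qint_add {q : ℂ} (hq0 : q ≠ 0) (a b : ℤ) :
    qint q (a + b) = q ^ b * qint q a + q ^ (-a) * qint q b := by
  simp only [qint, mul_div_assoc', ← add_div, mul_sub, ← zpow_add₀ hq0]
  congr 1
  rw [add_comm b a, show b + -a = -a + b by ring, show -(a + b) = -a + -b by ring]
  ring

/-- The `q`-binomial identity for the elementary symmetric functions of
`q⁻², q⁻⁴, …, q^(-2z)`. -/
lemma qfact_mul_sum_powersetCard {q : ℂ} (hq0 : q ≠ 0) (z k : ℕ) (hk : k ≤ z) :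
    qfact q k * qfact q (z - k) * q ^ ((k : ℤ) * (z + 1)) *
      (∑ S ∈ Finset.powersetCard k (Finset.range z), q ^ (-2 * ∑ j ∈ S, ((j : ℤ) + 1)))
      = qfact q z := by
  induction z generalizing k with
  | zero =>
    obtain rfl : k = 0 := by omega
    simp [qfact]
  | succ z ih =>
    rcases k with _ | k
    · simp [qfact]
    have hS : ∑ S ∈ Finset.powersetCard (k + 1) (Finset.range (z + 1)),
          q ^ (-2 * ∑ j ∈ S, ((j : ℤ) + 1))
        = (∑ S ∈ Finset.powersetCard (k + 1) (Finset.range z),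
            q ^ (-2 * ∑ j ∈ S, ((j : ℤ) + 1)))
          + q ^ (-2 * ((z : ℤ) + 1)) * ∑ S ∈ Finset.powersetCard k (Finset.range z),
            q ^ (-2 * ∑ j ∈ S, ((j : ℤ) + 1)) := by
      have hz : ∀ S ∈ Finset.powersetCard k (Finset.range z), z ∉ S := fun S hS h => by
        simpa using (Finset.mem_powersetCard.1 hS).1 h
      rw [Finset.range_add_one, Finset.powersetCard_succ_insert (by simp), Finset.sum_union,
        Finset.sum_image, Finset.mul_sum]
      · congr 1
        refine Finset.sum_congr rfl fun S hS => ?_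
        rw [Finset.sum_insert (hz S hS), mul_add, zpow_add₀ hq0]
      · intro S hS T hT h
        rw [← Finset.erase_insert (hz S hS), h, Finset.erase_insert (hz T hT)]
      · rw [Finset.disjoint_left]
        intro S hS h
        obtain ⟨T, -, rfl⟩ := Finset.mem_image.1 h
        simpa using (Finset.mem_powersetCard.1 hS).1 (Finset.mem_insert_self z T)
    have ih₁ := ih k (by omega)
    rw [hS, show z + 1 - (k + 1) = z - k by omega, qfact_succ q z, qfact_succ q k]
    set B := ∑ S ∈ Finset.powersetCard k (Finset.range z), q ^ (-2 * ∑ j ∈ S, ((j : ℤ) + 1))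
    have hB : q ^ (((k + 1 : ℕ) : ℤ) * (((z + 1 : ℕ) : ℤ) + 1)) * q ^ (-2 * ((z : ℤ) + 1))
        = q ^ (-((z : ℤ) - k)) * q ^ ((k : ℤ) * (z + 1)) := by
      rw [← zpow_add₀ hq0, ← zpow_add₀ hq0]
      congr 1
      push_cast
      ring
    rcases (show k = z ∨ k < z by omega) with rfl | hkz
    · rw [Finset.powersetCard_eq_empty.2 (by simp), Finset.sum_empty]
      simp only [sub_self, neg_zero, zpow_zero, one_mul] at hB
      linear_combination qint q (k + 1) * ih₁
        + qfact q k * qint q (k + 1) * qfact q (k - k) * B * hB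
    · have ih₂ := ih (k + 1) hkz
      obtain ⟨d, rfl⟩ : ∃ d, z = k + 1 + d := ⟨z - (k + 1), by omega⟩
      rw [show k + 1 + d - k = d + 1 by omega] at ih₁ ⊢
      rw [show k + 1 + d - (k + 1) = d by omega] at ih₂
      rw [qfact_succ] at ih₁ ih₂ ⊢
      set A := ∑ S ∈ Finset.powersetCard (k + 1) (Finset.range (k + 1 + d)),
        q ^ (-2 * ∑ j ∈ S, ((j : ℤ) + 1))
      have hA : q ^ (((k + 1 : ℕ) : ℤ) * (((k + 1 + d + 1 : ℕ) : ℤ) + 1))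
          = q ^ ((k : ℤ) + 1) * q ^ (((k + 1 : ℕ) : ℤ) * (((k + 1 + d : ℕ) : ℤ) + 1)) := by
        rw [← zpow_add₀ hq0]
        congr 1
        push_cast
        ring
      have hqi : qint q (((k + 1 + d : ℕ) : ℤ) + 1)
          = q ^ ((k : ℤ) + 1) * qint q ((d : ℤ) + 1)
            + q ^ (-((d : ℤ) + 1)) * qint q ((k : ℤ) + 1) := by
        rw [← qint_add hq0]
        congr 1
        push_cast
        ring
      rw [show -(((k + 1 + d : ℕ) : ℤ) - k) = -((d : ℤ) + 1) by push_cast; ring] at hB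
      rw [hqi]
      linear_combination q ^ ((k : ℤ) + 1) * qint q ((d : ℤ) + 1) * ih₂
        + q ^ (-((d : ℤ) + 1)) * qint q ((k : ℤ) + 1) * ih₁
        + qfact q k * qint q (k + 1) * qfact q d * qint q (d + 1) * A * hA
        + qfact q k * qint q (k + 1) * qfact q d * qint q (d + 1) * B * hB

lemma qfact_mul_sum_powersetCard_univ {q : ℂ} (hq0 : q ≠ 0) (z k : ℕ) (hk : k ≤ z) :
    qfact q k * qfact q (z - k) * q ^ ((k : ℤ) * (z + 1)) *
      (∑ S ∈ Finset.powersetCard k (Finset.univ : Finset (Fin z)), q ^ (-2 * posSum S))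
      = qfact q z := by
  rw [← qfact_mul_sum_powersetCard hq0 z k hk,
    show Finset.range z = (Finset.univ : Finset (Fin z)).map Fin.valEmbedding by
      ext; simp,
    Finset.powersetCard_map, Finset.sum_map]
  simp [posSum]

lemma qfact_ne_zero {q : ℂ} {p : ℕ} (hq : IsPrimitiveRoot (q ^ 2) p) (hq0 : q ≠ 0)
    (hq2 : q ^ 2 ≠ 1) {n : ℕ} (hn : n < p) : qfact q n ≠ 0 := by
  refine Finset.prod_ne_zero_iff.2 fun m hm => ?_
  have hm' := Finset.mem_range.1 hm
  have h := hq.pow_ne_one_of_pos_of_lt (Nat.succ_ne_zero m) (by omega)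
  refine div_ne_zero (fun h' => h ?_) (sub_inv_ne_zero hq0 hq2)
  have h0 : q ^ ((m : ℤ) + 1) = q ^ (-((m : ℤ) + 1)) := sub_eq_zero.1 h'
  rw [← pow_mul, mul_comm, pow_mul, sq]
  rw [← Nat.cast_succ] at h0
  nth_rewrite 1 [← zpow_natCast]
  rw [h0, zpow_neg, zpow_natCast, inv_mul_cancel₀ (pow_ne_zero _ hq0)]

end QuantumIntegers

section JonesWenzl

variable {q : ℂ}

lemma FOp_apply (z : ℕ) (v : Vz z) (t : Str z) :
    FOp q z v t = ∑ i ∈ onesOf t,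
      q ^ (-∑ j ∈ Finset.univ.filter (fun j => j < i), kwt (t j))
        * v (Function.update t i 0) := by
  have hpre : ∀ (i : Fin z) (s : Str z), (s i = 0 ∧ t = Function.update s i 1) ↔
      (s = Function.update t i 0 ∧ t i = 1) := by
    intro i s
    constructor
    · rintro ⟨h, rfl⟩
      simp [← h]
    · rintro ⟨rfl, h⟩
      simp [← h]
  rw [FOp, Matrix.mulVecLin_apply, Matrix.mulVec, dotProduct]
  simp_rw [Fmat, Finset.sum_mul, hpre]
  rw [Finset.sum_comm, onesOf, Finset.sum_filter]
  refine Finset.sum_congr rfl fun i _ => ?_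
  rw [Finset.sum_eq_single (Function.update t i 0) (by intro s _ hs; simp [hs]) (by simp)]
  by_cases hi : t i = 1
  · simp only [hi, and_self, if_true]
    congr 3
    refine Finset.sum_congr rfl fun j hj => ?_
    rw [Function.update_of_ne (Finset.mem_filter.1 hj).2.ne]
  · simp [hi]

lemma sq_sub_ediv_two_succ (k : ℕ) :
    (((k + 1 : ℕ) : ℤ) ^ 2 - ((k + 1 : ℕ) : ℤ)) / 2 = ((k : ℤ) ^ 2 - k) / 2 + k := by
  rw [← Int.add_mul_ediv_right _ _ two_ne_zero]
  congr 1
  push_cast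
  ring

lemma FOp_pow_x0 (hq0 : q ≠ 0) (hq2 : q ^ 2 ≠ 1) (z k : ℕ) (t : Str z) :
    (FOp q z ^ k) (x0 z) t = if (onesOf t).card = k then
      q ^ (((k : ℤ) ^ 2 - k) / 2 + k - posSum (onesOf t)) * qfact q k else 0 := by
  induction k generalizing t with
  | zero =>
    have : (onesOf t).card = 0 ↔ t = fun _ => 0 := by
      rw [Finset.card_eq_zero, Finset.eq_empty_iff_forall_notMem, funext_iff]
      simp only [mem_onesOf, fin_two_ne_one]
    simp only [CharP.cast_eq_zero, this]
    by_cases h : t = fun _ => 0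
    · simp [h, x0, rho, qfact, onesOf, posSum]
    · simp [h, x0, rho]
  | succ k ih =>
    rw [pow_succ', Module.End.mul_apply, FOp_apply]
    have hcard : ∀ i ∈ onesOf t, (onesOf (Function.update t i 0)).card = k ↔
        (onesOf t).card = k + 1 := by
      intro i hi
      have := Finset.card_erase_add_one hi
      rw [onesOf_update_zero]
      omega
    by_cases hk : (onesOf t).card = k + 1
    · rw [if_pos hk]
      have hterm : ∀ i ∈ onesOf t,
          q ^ (-∑ j ∈ Finset.univ.filter (fun j => j < i), kwt (t j))
            * (FOp q z ^ k) (x0 z) (Function.update t i 0)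
          = (q ^ (((k : ℤ) ^ 2 - k) / 2 + k + 1 - posSum (onesOf t)) * qfact q k)
            * (q ^ 2) ^ ((onesOf t).filter (fun j => j < i)).card := by
        intro i hi
        rw [ih, if_pos ((hcard i hi).2 hk), onesOf_update_zero, posSum_erase hi, sum_kwt_lt,
          ← pow_mul, ← zpow_natCast, ← mul_assoc, ← zpow_add₀ hq0, mul_right_comm,
          ← zpow_add₀ hq0]
        congr 2
        push_cast
        ring
      rw [Finset.sum_congr rfl hterm, ← Finset.mul_sum, sum_pow_card_filter_lt, hk,
        sum_pow_eq_qint hq0 hq2, qfact_succ, sq_sub_ediv_two_succ,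
        show ((k : ℤ) ^ 2 - k) / 2 + k + ((k + 1 : ℕ) : ℤ) - posSum (onesOf t)
          = (((k : ℤ) ^ 2 - k) / 2 + k + 1 - posSum (onesOf t)) + k by push_cast; ring,
        zpow_add₀ hq0 _ (k : ℤ)]
      ring
    · rw [if_neg hk]
      refine Finset.sum_eq_zero fun i hi => ?_
      rw [ih, if_neg (mt (hcard i hi).1 hk), mul_zero]

lemma jwMat_apply (hq0 : q ≠ 0) (hq2 : q ^ 2 ≠ 1) (n : ℕ) (t s : Str n) :
    jwMat q n t s = if (onesOf t).card = (onesOf s).card then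
      q ^ (((onesOf s).card : ℤ) * (n + 1)) * q ^ (-posSum (onesOf s)) * q ^ (-posSum (onesOf t))
        * (qfact q (n - (onesOf s).card) * qfact q (onesOf s).card / qfact q n) else 0 := by
  rw [jwMat, FOp_pow_x0 hq0 hq2]
  split_ifs with h
  · set k := (onesOf s).card
    have : q ^ ((k : ℤ) * n - ((k : ℤ) ^ 2 - k) / 2 - posSum (onesOf s))
        * q ^ (((k : ℤ) ^ 2 - k) / 2 + k - posSum (onesOf t))
        = q ^ ((k : ℤ) * (n + 1)) * q ^ (-posSum (onesOf s)) * q ^ (-posSum (onesOf t)) := by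
      simp only [← zpow_add₀ hq0]
      congr 1
      ring
    rw [← this]
    ring
  · simp

lemma jwMat_mul_self (hq0 : q ≠ 0) (hq2 : q ^ 2 ≠ 1) {n : ℕ} (hn : qfact q n ≠ 0) :
    jwMat q n * jwMat q n = jwMat q n := by
  ext t s
  rw [Matrix.mul_apply]
  simp_rw [jwMat_apply hq0 hq2]
  set k := (onesOf s).card with hk
  have hkn : k ≤ n := by simpa using (onesOf s).card_le_univ
  have key := qfact_mul_sum_powersetCard_univ hq0 n k hkn
  by_cases hts : (onesOf t).card = k
  · have hsum : ∑ S ∈ Finset.powersetCard k (Finset.univ : Finset (Fin n)), q ^ (-2 * posSum S)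
        = ∑ u : Str n, if (onesOf u).card = k then q ^ (-2 * posSum (onesOf u)) else 0 := by
      rw [Finset.powersetCard_eq_filter, Finset.powerset_univ, Finset.sum_filter,
        ← (onesEquiv n).sum_comp]
      rfl
    rw [hsum] at key
    rw [if_pos hts]
    set c := qfact q (n - k) * qfact q k / qfact q n with hc
    have hone : q ^ ((k : ℤ) * (n + 1)) * c *
        ∑ u : Str n, (if (onesOf u).card = k then q ^ (-2 * posSum (onesOf u)) else 0) = 1 := by
      rw [hc]
      field_simp
      linear_combination key
    have hterm : ∀ u : Str n,
        ((if (onesOf t).card = (onesOf u).card then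
          q ^ (((onesOf u).card : ℤ) * (n + 1)) * q ^ (-posSum (onesOf u))
            * q ^ (-posSum (onesOf t))
            * (qfact q (n - (onesOf u).card) * qfact q (onesOf u).card / qfact q n) else 0)
          * if (onesOf u).card = k then
            q ^ ((k : ℤ) * (n + 1)) * q ^ (-posSum (onesOf s)) * q ^ (-posSum (onesOf u)) * c
            else 0)
        = (q ^ ((k : ℤ) * (n + 1)) * q ^ (-posSum (onesOf s)) * q ^ (-posSum (onesOf t)) * c)
          * (q ^ ((k : ℤ) * (n + 1)) * c) *
            if (onesOf u).card = k then q ^ (-2 * posSum (onesOf u)) else 0 := by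
      intro u
      by_cases hu : (onesOf u).card = k
      · have h2 : q ^ (-2 * posSum (onesOf u))
            = q ^ (-posSum (onesOf u)) * q ^ (-posSum (onesOf u)) := by
          rw [← zpow_add₀ hq0]
          congr 1
          ring
        rw [if_pos hu, if_pos hu, hu, if_pos hts, h2]
        ring
      · simp [hu]
    rw [Finset.sum_congr rfl fun u _ => hterm u, ← Finset.mul_sum, mul_assoc, hone, mul_one]
  · rw [if_neg hts]
    refine Finset.sum_eq_zero fun u _ => ?_
    by_cases hu : (onesOf u).card = k
    · rw [hu, if_neg hts, zero_mul]
    · rw [if_neg hu, mul_zero]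

lemma jwMat_swap_left (hq0 : q ≠ 0) (hq2 : q ^ 2 ≠ 1) {n : ℕ} {t : Str n} {i j : Fin n}
    (hij : (j : ℕ) = i + 1) (hi : t i = 1) (hj : t j = 0) (s : Str n) :
    q * jwMat q n (t ∘ Equiv.swap i j) s = jwMat q n t s := by
  rw [jwMat_apply hq0 hq2, jwMat_apply hq0 hq2, card_onesOf_swap hi hj, posSum_onesOf_swap hi hj,
    show -(posSum (onesOf t) + j - i) = -posSum (onesOf t) - 1 by rw [hij]; push_cast; ring,
    zpow_sub_one₀ hq0]
  split_ifs
  · field_simp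
  · simp

lemma jwMat_swap_right (hq0 : q ≠ 0) (hq2 : q ^ 2 ≠ 1) {n : ℕ} {s : Str n} {i j : Fin n}
    (hij : (j : ℕ) = i + 1) (hi : s i = 1) (hj : s j = 0) (t : Str n) :
    q * jwMat q n t (s ∘ Equiv.swap i j) = jwMat q n t s := by
  rw [jwMat_apply hq0 hq2, jwMat_apply hq0 hq2, card_onesOf_swap hi hj, posSum_onesOf_swap hi hj,
    show -(posSum (onesOf s) + j - i) = -posSum (onesOf s) - 1 by rw [hij]; push_cast; ring,
    zpow_sub_one₀ hq0]
  split_ifs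
  · field_simp
  · simp

/-- A sum over strings vanishes when the summand is supported on the strings with different values
at `i` and `j`, and exchanging these values changes its sign. -/
lemma sum_str_eq_zero_of_swap {n : ℕ} {i j : Fin n} (f : Str n → ℂ)
    (heq : ∀ s, s i = s j → f s = 0)
    (hswap : ∀ s, s i = 1 → s j = 0 → f s + f (s ∘ Equiv.swap i j) = 0) :
    ∑ s, f s = 0 := by
  have hinv : ∀ s : Str n, (s ∘ Equiv.swap i j) ∘ Equiv.swap i j = s := by
    intro s; funext k; simp
  refine Finset.sum_involution (fun s _ => s ∘ Equiv.swap i j) (fun s _ => ?_)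
    (fun s _ hs h => hs (heq s ?_)) (fun _ _ => Finset.mem_univ _) (fun s _ => hinv s)
  · by_cases hi : s i = 1
    · by_cases hj : s j = 1
      · rw [heq s (hi.trans hj.symm), heq _ (by simp [hi, hj]), add_zero]
      · exact hswap s hi (fin_two_ne_one.1 hj)
    · have hi' := fin_two_ne_one.1 hi
      by_cases hj : s j = 1
      · have h := hswap (s ∘ Equiv.swap i j) (by simp [hj]) (by simp [hi'])
        rwa [hinv, add_comm] at h
      · have hj' := fin_two_ne_one.1 hj
        rw [heq s (hi'.trans hj'.symm), heq _ (by simp [hi', hj']), add_zero]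
  · simpa using (congrFun h j)

lemma comp_swap_skip {N M i : ℕ} (hi : i + 1 < N) (s : Str N) (k : Fin M)
    (hk : (if (k : ℕ) < i then (k : ℕ) else (k : ℕ) + 2) < N) :
    (s ∘ Equiv.swap (⟨i, by omega⟩ : Fin N) ⟨i + 1, hi⟩)
        ⟨if (k : ℕ) < i then (k : ℕ) else (k : ℕ) + 2, hk⟩
      = s ⟨if (k : ℕ) < i then (k : ℕ) else (k : ℕ) + 2, hk⟩ := by
  rw [Function.comp_apply, Equiv.swap_apply_of_ne_of_ne] <;>
    simp only [ne_eq, Fin.mk.injEq] <;> split_ifs <;> omega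

lemma cupMat_mul_jwMat (hq0 : q ≠ 0) (hq2 : q ^ 2 ≠ 1) (N M i : ℕ) (h : N = M + 2)
    (hi : i + 1 < N) : cupMat q N M i h hi * jwMat q N = 0 := by
  ext t s
  rw [Matrix.mul_apply]
  refine sum_str_eq_zero_of_swap (i := ⟨i, by omega⟩) (j := ⟨i + 1, hi⟩) _ ?_ ?_
  · intro u hu
    have hne : ¬ (u ⟨i + 1, hi⟩ = 1 ∧ u ⟨i + 1, hi⟩ = 0) := by rintro ⟨h₁, h₀⟩; simp_all
    simp [cupMat, hu, hne, and_comm.not.1 hne]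
  · intro u hu₁ hu₀
    have hsw := jwMat_swap_left hq0 hq2 (n := N) rfl hu₁ hu₀ s
    simp only [cupMat]
    simp only [comp_swap_skip]
    simp only [Function.comp_apply, Equiv.swap_apply_left, Equiv.swap_apply_right, hu₁, hu₀,
      and_self, zero_ne_one, one_ne_zero, if_true, if_false]
    split_ifs
    · linear_combination -hsw
    · simp

lemma jwMat_mul_capMat (hq0 : q ≠ 0) (hq2 : q ^ 2 ≠ 1) (N M i : ℕ) (h : N = M + 2)
    (hi : i + 1 < N) : jwMat q N * capMat q N M i h hi = 0 := by
  ext t s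
  rw [Matrix.mul_apply]
  refine sum_str_eq_zero_of_swap (i := ⟨i, by omega⟩) (j := ⟨i + 1, hi⟩) _ ?_ ?_
  · intro u hu
    have hne : ¬ (u ⟨i + 1, hi⟩ = 1 ∧ u ⟨i + 1, hi⟩ = 0) := by rintro ⟨h₁, h₀⟩; simp_all
    simp [capMat, hu, hne, and_comm.not.1 hne]
  · intro u hu₁ hu₀
    have hsw := jwMat_swap_right hq0 hq2 (n := N) rfl hu₁ hu₀ t
    simp only [capMat]
    simp only [comp_swap_skip]
    simp only [Function.comp_apply, Equiv.swap_apply_left, Equiv.swap_apply_right, hu₁, hu₀,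
      and_self, zero_ne_one, one_ne_zero, if_true, if_false]
    split_ifs
    · rw [← hsw]
      field_simp
      ring
    · simp

end JonesWenzl

/-- for `1 ≤ n ≤ p - 1`, the map `G_n` satisfies `G_n∘G_n = G_n` and
`G_n∘eⱼ = eⱼ∘G_n = 0` for `1 ≤ j ≤ n - 1`, where `eⱼ = ∩ⱼ∘∪ⱼ` (positions passed
0-indexed); i.e. `G_n` is the Jones–Wenzl projection. -/
theorem stmt6 (p : ℕ) (hp : 2 ≤ p) (q : ℂ)
    (hq : q = Complex.exp (Real.pi * Complex.I / p))
    (n : ℕ) (hn1 : 1 ≤ n) (hn2 : n ≤ p - 1) :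
    jwOp q n ∘ₗ jwOp q n = jwOp q n ∧
      ∀ (j : ℕ) (hj1 : 1 ≤ j) (hj2 : j + 1 ≤ n),
        jwOp q n ∘ₗ
            (capOp q n (n - 2) (j - 1) (by omega) (by omega) ∘ₗ
              cupOp q n (n - 2) (j - 1) (by omega) (by omega)) = 0 ∧
          (capOp q n (n - 2) (j - 1) (by omega) (by omega) ∘ₗ
              cupOp q n (n - 2) (j - 1) (by omega) (by omega)) ∘ₗ jwOp q n = 0 := by
  have hq0 : q ≠ 0 := hq ▸ Complex.exp_ne_zero _
  have hprim : IsPrimitiveRoot (q ^ 2) p := by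
    have h : q ^ 2 = Complex.exp (2 * Real.pi * Complex.I / p) := by
      rw [hq, ← Complex.exp_nat_mul]
      congr 1
      push_cast
      ring
    rw [h]
    exact Complex.isPrimitiveRoot_exp p (by omega)
  have hq2 : q ^ 2 ≠ 1 := hprim.ne_one (by omega)
  have hn := qfact_ne_zero hprim hq0 hq2 (show n < p by omega)
  refine ⟨?_, fun j hj1 hj2 => ⟨?_, ?_⟩⟩
  · rw [jwOp, ← Matrix.mulVecLin_mul, jwMat_mul_self hq0 hq2 hn]
  · rw [← LinearMap.comp_assoc, jwOp, capOp, ← Matrix.mulVecLin_mul,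
      jwMat_mul_capMat hq0 hq2, Matrix.mulVecLin_zero, LinearMap.zero_comp]
  · rw [LinearMap.comp_assoc, jwOp, cupOp, ← Matrix.mulVecLin_mul,
      cupMat_mul_jwMat hq0 hq2, Matrix.mulVecLin_zero, LinearMap.comp_zero]
end
end

section
/- For every z ≥ 1 and 0 ≤ k ≤ z, E_z^k x_{z,z} = Σ_{1 ≤ i₁ < ⋯ < i_{z−k} ≤ z} q^{(z−k)(z−k+1)/2 − (i₁+⋯+i_{z−k})}·([k]!)·ρ_{i₁,…,i_{z−k},z}. -/
noncomputable section

/-- The number of elements of `C` above `i` runs once through `0, …, #C - 1` as `i` runs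
through `C`. -/
theorem sum_card_filter_lt {α M : Type*} [LinearOrder α] [AddCommMonoid M] (f : ℕ → M)
    (C : Finset α) :
    ∑ i ∈ C, f (C.filter fun j => i < j).card = ∑ a ∈ Finset.range C.card, f a := by
  refine Finset.induction_on_min C (by simp) fun a s ha ih => ?_
  have hn : a ∉ s := fun h => lt_irrefl _ (ha a h)
  rw [Finset.sum_insert hn, Finset.card_insert_of_notMem hn, Finset.sum_range_succ, ← ih,
    add_comm]
  congr 1
  · refine Finset.sum_congr rfl fun i hi => ?_
    rw [Finset.filter_insert, if_neg (ha i hi).not_gt]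
  · rw [Finset.filter_insert, if_neg (lt_irrefl a), Finset.filter_true_of_mem ha]

theorem sum_zpow_eq_qint {q : ℂ} (hq0 : q ≠ 0) (hq1 : q ^ 2 ≠ 1) (n : ℕ) :
    ∑ a ∈ Finset.range n, q ^ (2 * (a : ℤ)) = q ^ ((n : ℤ) - 1) * qint q n := by
  have hd : q - q⁻¹ ≠ 0 := fun h => hq1 <| by
    have : q = q⁻¹ := sub_eq_zero.mp h
    rw [sq]
    nth_rewrite 2 [this]
    exact mul_inv_cancel₀ hq0
  unfold qint
  rw [← mul_div_assoc, eq_div_iff hd, mul_sub (q ^ _), ← zpow_add₀ hq0, ← zpow_add₀ hq0]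
  induction n with
  | zero => simp
  | succ n ih =>
    rw [Finset.sum_range_succ, add_mul, ih, mul_sub, ← zpow_neg_one, ← zpow_add_one₀ hq0,
      ← zpow_add₀ hq0]
    push_cast
    ring_nf

theorem eq_indicator_iff {z : ℕ} (t : Str z) (S : Finset (Fin z)) :
    t = (fun j => if j ∈ S then 1 else 0) ↔ onesOf t = S := by
  constructor
  · rintro rfl
    ext j
    simp [onesOf]
  · rintro rfl
    ext j
    have : t j = 0 ∨ t j = 1 := by lia
    rcases this with h | h <;> simp [onesOf, h]

theorem rho_apply {z : ℕ} (S : Finset (Fin z)) (t : Str z) :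
    rho z S t = if onesOf t = S then 1 else 0 := by
  simp only [rho, eq_indicator_iff]

theorem EOp_apply (q : ℂ) {z : ℕ} (v : Vz z) (t : Str z) :
    EOp q z v t = ∑ i ∈ (onesOf t)ᶜ,
      q ^ (∑ j ∈ Finset.univ.filter (fun j => i < j), kwt (t j)) * v (Function.update t i 1) := by
  have key : ∀ (i : Fin z) (s : Str z), (s i = 1 ∧ t = Function.update s i 0) ↔
      (i ∈ (onesOf t)ᶜ ∧ s = Function.update t i 1) := by
    intro i s
    constructor
    · rintro ⟨h, rfl⟩
      refine ⟨by simp [onesOf], ?_⟩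
      rw [Function.update_idem, ← h, Function.update_eq_self]
    · rintro ⟨h, rfl⟩
      have h0 : t i = 0 := by
        simp [onesOf] at h
        lia
      simp [← h0]
  simp only [EOp, Matrix.mulVecLin_apply, Matrix.mulVec, dotProduct, Emat, Finset.sum_mul, key]
  rw [Finset.sum_comm, ← Finset.sum_subset (Finset.subset_univ (onesOf t)ᶜ)]
  · refine Finset.sum_congr rfl fun i hi => ?_
    rw [Finset.sum_eq_single (Function.update t i 1)]
    · rw [if_pos ⟨hi, rfl⟩]
      congr 2
      refine Finset.sum_congr rfl fun j hj => ?_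
      rw [Function.update_of_ne (Finset.mem_filter.mp hj).2.ne']
    · intro s _ hs
      simp [hs]
    · simp
  · intro i _ hi
    simp [hi]

theorem onesOf_update {z : ℕ} (t : Str z) (i : Fin z) :
    onesOf (Function.update t i 1) = insert i (onesOf t) := by
  ext j
  by_cases h : j = i
  · subst h
    simp [onesOf]
  · simp [onesOf, h]

theorem sum_kwt_above {z : ℕ} (t : Str z) (i : Fin z) :
    ∑ j ∈ Finset.univ.filter (fun j => i < j), kwt (t j)
      = 2 * (((onesOf t)ᶜ.filter fun j => i < j).card : ℤ) - z + ((i : ℕ) + 1) := by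
  have hk : ∀ j, kwt (t j) = 2 * (if j ∈ (onesOf t)ᶜ then 1 else 0) - 1 := by
    intro j
    have : t j = 0 ∨ t j = 1 := by lia
    rcases this with h | h <;> simp [kwt, onesOf, h]
  have hc : (Finset.univ.filter fun j => i < j) = Finset.Ioi i := by
    ext j
    simp
  have hs : (Finset.Ioi i).filter (· ∈ (onesOf t)ᶜ) = (onesOf t)ᶜ.filter fun j => i < j := by
    ext j
    simp [and_comm]
  simp only [hk, hc]
  rw [Finset.sum_sub_distrib, ← Finset.mul_sum, Finset.sum_boole, hs]
  simp only [Finset.sum_const, Fin.card_Ioi, nsmul_eq_mul, mul_one]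
  have := i.isLt
  lia

theorem EOp_pow_xtop_apply {q : ℂ} (hq0 : q ≠ 0) (hq1 : q ^ 2 ≠ 1) {z : ℕ} (k : ℕ) (t : Str z) :
    (EOp q z ^ k) (xtop z) t =
      if (onesOf t).card + k = z then
        q ^ (((onesOf t).card : ℤ) * ((onesOf t).card + 1) / 2 - posSum (onesOf t)) * qfact q k
      else 0 := by
  induction k generalizing t with
  | zero =>
    have hu : onesOf t = Finset.univ ↔ (onesOf t).card = z := by
      rw [← Finset.card_eq_iff_eq_univ, Fintype.card_fin]
    simp only [pow_zero, Module.End.one_apply, xtop, rho_apply, add_zero, qfact,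
      Finset.range_zero, Finset.prod_empty, mul_one, ← hu]
    split_ifs with h
    · have hp : posSum (Finset.univ : Finset (Fin z)) = (z : ℤ) * (z + 1) / 2 := by
        have : ∀ n : ℕ, 2 * ∑ j : Fin n, (((j : ℕ) : ℤ) + 1) = (n : ℤ) * (n + 1) := by
          intro n
          induction n with
          | zero => simp
          | succ n ih =>
            rw [Fin.sum_univ_castSucc, mul_add]
            simp only [Fin.val_castSucc, ih, Fin.val_last]
            push_cast
            ring
        have := this z
        unfold posSum
        lia
      rw [h, hp]
      simp
    · rfl
  | succ k ih =>
    have hcard : (onesOf t).card + (onesOf t)ᶜ.card = z := by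
      simp
    rw [pow_succ', Module.End.mul_apply, EOp_apply]
    set m := (onesOf t).card with hm
    have hterm : ∀ i ∈ (onesOf t)ᶜ,
        q ^ (∑ j ∈ Finset.univ.filter (fun j => i < j), kwt (t j))
            * (EOp q z ^ k) (xtop z) (Function.update t i 1)
          = (if m + (k + 1) = z then
              q ^ ((m : ℤ) * (m + 1) / 2 + (m + 1) - posSum (onesOf t) - z) * qfact q k else 0)
            * q ^ (2 * (((onesOf t)ᶜ.filter fun j => i < j).card : ℤ)) := by
      intro i hi
      have hi' : i ∉ onesOf t := Finset.mem_compl.mp hi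
      rw [ih, onesOf_update, Finset.card_insert_of_notMem hi', ← hm, sum_kwt_above]
      have hp : posSum (insert i (onesOf t)) = ((i : ℕ) + 1) + posSum (onesOf t) :=
        Finset.sum_insert hi'
      have hd : ((m + 1 : ℕ) : ℤ) * ((m + 1 : ℕ) + 1) / 2 = (m : ℤ) * (m + 1) / 2 + (m + 1) := by
        rw [← Int.add_mul_ediv_right _ _ two_ne_zero]
        push_cast
        ring_nf
      rw [hp, hd, add_right_comm m 1 k, add_assoc m k 1]
      split_ifs
      · rw [← mul_assoc, ← zpow_add₀ hq0, mul_right_comm, ← zpow_add₀ hq0]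
        congr 2
        ring
      · simp
    rw [Finset.sum_congr rfl hterm, ← Finset.mul_sum,
      sum_card_filter_lt (fun a => q ^ (2 * (a : ℤ))), sum_zpow_eq_qint hq0 hq1]
    split_ifs with h
    · have hc : (onesOf t)ᶜ.card = k + 1 := by lia
      have hz : (z : ℤ) = m + (k + 1) := by exact_mod_cast h.symm
      have hf : qfact q (k + 1) = qfact q k * qint q ((k + 1 : ℕ) : ℤ) := by
        simp [qfact, Finset.prod_range_succ]
      rw [hc, hf, mul_mul_mul_comm, ← zpow_add₀ hq0, hz]
      congr 2
      push_cast
      ring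
    · simp

/-- `E_z^k x_{z,z} = Σ_{1 ≤ i₁ < ⋯ < i_{z-k} ≤ z}
q^{(z-k)(z-k+1)/2 - Σ iⱼ}·[k]!·ρ_{i₁,…,i_{z-k},z}`. -/
theorem stmt16 (q : ℂ) (hq0 : q ≠ 0) (hq1 : q ^ 2 ≠ 1)
    (z : ℕ) (hz : 1 ≤ z) (k : ℕ) (hk : k ≤ z) :
    (EOp q z ^ k) (xtop z)
      = ∑ S ∈ Finset.powersetCard (z - k) (Finset.univ : Finset (Fin z)),
          (q ^ (((z : ℤ) - (k : ℤ)) * ((z : ℤ) - (k : ℤ) + 1) / 2 - posSum S)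
            * qfact q k) • rho z S := by
  ext t
  rw [EOp_pow_xtop_apply hq0 hq1, Finset.sum_apply]
  simp only [Pi.smul_apply, rho_apply, smul_eq_mul, mul_ite, mul_one, mul_zero]
  rw [Finset.sum_ite_eq]
  simp only [Finset.mem_powersetCard, Finset.subset_univ, true_and]
  have hiff : (onesOf t).card + k = z ↔ (onesOf t).card = z - k := by lia
  simp only [hiff]
  split_ifs with h
  · have : ((onesOf t).card : ℤ) = z - k := by lia
    rw [this]
  · rfl

end
end
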